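/- arXiv:1407.2755 — 2 statements merged into one kernel-verified Lean document; each statement's English description precedes it below -/
import Mathlib

section
/- For any positive integer r, any nonnegative integers ν₁,…,ν_{r-1}, κ, and any positive integer n, all zeros of the polynomial F_n(x) = Σ_{k=0}^n C(n,k) · (n+κ)_k · (−x)^k / (k! · (ν₁+k)! ⋯ (ν_{r-1}+k)!) are real and positive. -/
open Finset

open Polynomial ComplexOrder ComplexConjugate

theorem Complex.exists_inv_sub_eq {a z : ℂ} (ha : 0 ≤ a) :
    ∃ A B : ℝ, 0 ≤ A ∧ 0 ≤ B ∧ (z - a)⁻¹ = A * conj z - B := by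
  obtain ⟨x, hx, rfl⟩ := RCLike.nonneg_iff_exists_ofReal.mp ha
  refine ⟨(Complex.normSq (z - x))⁻¹, x * (Complex.normSq (z - x))⁻¹,
    inv_nonneg.mpr (Complex.normSq_nonneg _),
    mul_nonneg hx (inv_nonneg.mpr (Complex.normSq_nonneg _)), ?_⟩
  change (z - (x : ℂ))⁻¹ = _
  rw [Complex.inv_def]
  simp only [map_sub, Complex.conj_ofReal]
  push_cast
  ring

namespace Polynomial

theorem exists_eval_derivative_eq_of_roots_nonneg {f : ℂ[X]} (hf : ∀ a, f.IsRoot a → 0 ≤ a)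
    {z : ℂ} (hz : ¬ f.IsRoot z) :
    ∃ A B : ℝ, 0 ≤ A ∧ 0 ≤ B ∧ f.derivative.eval z = f.eval z * (A * conj z - B) := by
  have key : ∀ s : Multiset ℂ, (∀ a ∈ s, 0 ≤ a ∧ a ≠ z) →
      ∃ A B : ℝ, 0 ≤ A ∧ 0 ≤ B ∧ (s.map (X - C ·)).prod.derivative.eval z =
        (s.map (X - C ·)).prod.eval z * (A * conj z - B) := by
    intro s
    induction s using Multiset.induction_on with
    | empty => exact fun _ => ⟨0, 0, le_rfl, le_rfl, by simp⟩
    | cons a s ih =>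
      intro h
      obtain ⟨A, B, hA, hB, hs⟩ := ih fun b hb => h b (Multiset.mem_cons_of_mem hb)
      obtain ⟨ha, haz⟩ := h a (Multiset.mem_cons_self a s)
      obtain ⟨A', B', hA', hB', hinv⟩ := Complex.exists_inv_sub_eq (z := z) ha
      refine ⟨A + A', B + B', by positivity, by positivity, ?_⟩
      have hmul : (z - a) * (A' * conj z - B') = 1 := by
        rw [← hinv, mul_inv_cancel₀ (sub_ne_zero.mpr haz.symm)]
      simp only [Multiset.map_cons, Multiset.prod_cons, derivative_mul, derivative_sub,
        derivative_X, derivative_C, sub_zero, one_mul, eval_add, eval_mul, eval_sub, eval_X,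
        eval_C, hs]
      push_cast
      linear_combination (-eval z (s.map (X - C ·)).prod) * hmul
  obtain ⟨A, B, hA, hB, h⟩ := key f.roots fun a ha =>
    ⟨hf a (isRoot_of_mem_roots ha), fun haz => hz (haz ▸ isRoot_of_mem_roots ha)⟩
  refine ⟨A, B, hA, hB, ?_⟩
  rw [(IsAlgClosed.splits f).eq_prod_roots, derivative_C_mul, eval_C_mul, eval_C_mul, h, mul_assoc]

theorem pos_of_isRoot_X_mul_derivative_add {f : ℂ[X]} (hf : ∀ a, f.IsRoot a → 0 < a)
    {c : ℝ} (hc : 0 < c) {z : ℂ} (hz : (X * derivative f + C (c : ℂ) * f).IsRoot z) : 0 < z := by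
  by_cases hfz : f.IsRoot z
  · exact hf z hfz
  obtain ⟨A, B, hA, hB, h⟩ :=
    exists_eval_derivative_eq_of_roots_nonneg (fun a ha => (hf a ha).le) hfz
  simp only [IsRoot.def, eval_add, eval_mul, eval_X, eval_C, h] at hz hfz
  have hzB : z * B = ((A * Complex.normSq z + c : ℝ) : ℂ) := by
    apply mul_left_cancel₀ hfz
    push_cast
    rw [← Complex.mul_conj]
    linear_combination -hz
  have hpos : 0 < A * Complex.normSq z + c := by
    have := Complex.normSq_nonneg z
    positivity
  have hB0 : B ≠ 0 := by
    rintro rfl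
    rw [Complex.ofReal_zero, mul_zero, eq_comm, Complex.ofReal_eq_zero] at hzB
    exact hpos.ne' hzB
  rw [eq_div_of_mul_eq (Complex.ofReal_ne_zero.mpr hB0) hzB, ← Complex.ofReal_div,
    Complex.zero_lt_real]
  positivity

theorem nonneg_of_isRoot_derivative_sub {f : ℂ[X]} (hf : ∀ a, f.IsRoot a → 0 ≤ a)
    {α : ℂ} (hα : 0 < α) {z : ℂ} (hz : (derivative f - C α * f).IsRoot z) : 0 ≤ z := by
  by_cases hfz : f.IsRoot z
  · exact hf z hfz
  obtain ⟨A, B, hA, hB, h⟩ := exists_eval_derivative_eq_of_roots_nonneg hf hfz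
  obtain ⟨x, hx, rfl⟩ := RCLike.pos_iff_exists_ofReal.mp hα
  simp only [IsRoot.def, eval_sub, eval_mul, eval_C, h] at hz hfz
  have hzA : conj z * A = ((B + x : ℝ) : ℂ) := by
    apply mul_left_cancel₀ hfz
    push_cast
    linear_combination hz
  have hA0 : A ≠ 0 := by
    rintro rfl
    rw [Complex.ofReal_zero, mul_zero, eq_comm, Complex.ofReal_eq_zero] at hzA
    exact (add_pos_of_nonneg_of_pos hB hx).ne' hzA
  have hconj := eq_div_of_mul_eq (Complex.ofReal_ne_zero.mpr hA0) hzA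
  rw [← Complex.ofReal_div] at hconj
  rw [← Complex.conj_conj z, hconj, Complex.conj_ofReal, Complex.zero_le_real]
  positivity

theorem nonneg_of_isRoot_aeval_derivative {q : ℂ[X]} (hq : ∀ a, q.IsRoot a → 0 < a)
    {f : ℂ[X]} (hf : ∀ a, f.IsRoot a → 0 ≤ a) {z : ℂ}
    (hz : (aeval (derivative : ℂ[X] →ₗ[ℂ] ℂ[X]) q f).IsRoot z) : 0 ≤ z := by
  have key : ∀ s : Multiset ℂ, (∀ a ∈ s, 0 < a) → ∀ w,
      (aeval (derivative : ℂ[X] →ₗ[ℂ] ℂ[X]) (s.map (X - C ·)).prod f).IsRoot w → 0 ≤ w := by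
    intro s
    induction s using Multiset.induction_on with
    | empty => simpa using hf
    | cons a s ih =>
      intro h w hw
      refine nonneg_of_isRoot_derivative_sub (ih fun b hb => h b (Multiset.mem_cons_of_mem hb))
        (h a (Multiset.mem_cons_self a s)) ?_
      simpa [Module.algebraMap_end_apply, smul_eq_C_mul] using hw
  have hq0 : q ≠ 0 := by
    rintro rfl
    simpa using hq 0
  refine key q.roots (fun a ha => hq a (isRoot_of_mem_roots ha)) z ?_
  rw [(IsAlgClosed.splits q).eq_prod_roots] at hz
  simpa [Module.algebraMap_end_apply, hq0] using hz

theorem pos_of_isRoot_reverse {p : ℂ[X]} (hp : ∀ a, p.IsRoot a → 0 < a) {z : ℂ}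
    (hz : p.reverse.IsRoot z) : 0 < z := by
  have hp0 : p ≠ 0 := by
    rintro rfl
    simpa using hp 0
  have hz0 : z ≠ 0 := by
    rintro rfl
    rw [IsRoot.def, ← coeff_zero_eq_eval_zero, coeff_zero_reverse, leadingCoeff_eq_zero] at hz
    exact hp0 hz
  let _ : Invertible z⁻¹ := invertibleOfNonzero (inv_ne_zero hz0)
  have h := (eval₂_reverse_eq_zero_iff (RingHom.id ℂ) z⁻¹ p).mp (by simpa [eval₂_id] using hz)
  exact inv_pos.mp (hp _ (by simpa [eval₂_id] using h))

theorem eval_aeval_derivative_reverse_X_pow (p : ℂ[X]) (m : ℕ) (z : ℂ) :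
    (aeval (derivative : ℂ[X] →ₗ[ℂ] ℂ[X]) p.reverse (X ^ (p.natDegree + m))).eval z =
      (p.natDegree + m).factorial * z ^ m *
        ∑ k ∈ range (p.natDegree + 1), p.coeff k / (k + m).factorial * z ^ k := by
  rw [aeval_eq_sum_range' (Nat.lt_succ_of_le p.reverse_natDegree_le), LinearMap.sum_apply,
    eval_finsetSum, ← sum_range_reflect, mul_sum]
  refine sum_congr rfl fun k hk => ?_
  have hk' : k ≤ p.natDegree := Nat.lt_succ_iff.mp (mem_range.mp hk)
  have hsub : p.natDegree + 1 - 1 - k = p.natDegree - k := by omega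
  have hexp : p.natDegree + m - (p.natDegree - k) = k + m := by omega
  have hfac := Nat.factorial_mul_descFactorial
    (show p.natDegree - k ≤ p.natDegree + m by omega)
  rw [hexp] at hfac
  rw [Nat.succ_eq_add_one, hsub, LinearMap.smul_apply, Module.End.pow_apply,
    iterate_derivative_X_pow_eq_smul, hexp, coeff_reverse, revAt_le (Nat.sub_le _ _),
    Nat.sub_sub_self hk', ← hfac]
  have hne : ((k + m).factorial : ℂ) ≠ 0 := Nat.cast_ne_zero.mpr (Nat.factorial_ne_zero _)
  simp only [eval_smul, eval_pow, eval_X, smul_eq_mul]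
  push_cast
  field_simp
  ring

theorem exists_coeff_eq_div_factorial {p : ℂ[X]} (hp : ∀ a, p.IsRoot a → 0 < a) (m : ℕ) :
    ∃ q : ℂ[X], (∀ a, q.IsRoot a → 0 < a) ∧ ∀ k, q.coeff k = p.coeff k / (k + m).factorial := by
  have hcoeff : ∀ k, (∑ i ∈ range (p.natDegree + 1),
      monomial i (p.coeff i / ((i + m).factorial : ℂ))).coeff k =
        p.coeff k / (k + m).factorial := by
    intro k
    simp only [finsetSum_coeff, coeff_monomial, sum_ite_eq', mem_range]
    split_ifs with h
    · rfl
    · rw [coeff_eq_zero_of_natDegree_lt (by omega), zero_div]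
  refine ⟨_, fun z hz => ?_, hcoeff⟩
  refine lt_of_le_of_ne ?_ ?_
  · refine nonneg_of_isRoot_aeval_derivative (f := X ^ (p.natDegree + m))
      (fun a ha => pos_of_isRoot_reverse hp ha) (fun a ha => ?_) ?_ (q := p.reverse)
    · rw [IsRoot.def, eval_pow, eval_X] at ha
      exact (eq_zero_of_pow_eq_zero ha).ge
    · rw [IsRoot.def, eval_finsetSum] at hz
      simp only [eval_monomial] at hz
      rw [IsRoot.def, eval_aeval_derivative_reverse_X_pow, hz, mul_zero]
  · rintro rfl
    rw [IsRoot.def, ← coeff_zero_eq_eval_zero, hcoeff, div_eq_zero_iff] at hz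
    rcases hz with hz | hz
    · rw [coeff_zero_eq_eval_zero] at hz
      exact lt_irrefl _ (hp 0 hz)
    · exact Nat.cast_ne_zero.mpr (Nat.factorial_ne_zero _) hz

theorem exists_coeff_eq_div_prod_factorial {p : ℂ[X]} (hp : ∀ a, p.IsRoot a → 0 < a)
    (ν : ℕ → ℕ) (s : ℕ) :
    ∃ q : ℂ[X], (∀ a, q.IsRoot a → 0 < a) ∧
      ∀ k, q.coeff k = p.coeff k / ∏ i ∈ range s, ((ν i + k).factorial : ℂ) := by
  induction s with
  | zero => exact ⟨p, hp, by simp⟩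
  | succ s ih =>
    obtain ⟨q, hq, hqc⟩ := ih
    obtain ⟨g, hg, hgc⟩ := exists_coeff_eq_div_factorial hq (ν s)
    refine ⟨g, hg, fun k => ?_⟩
    rw [hgc, hqc, prod_range_succ, div_div, add_comm k]

theorem exists_coeff_eq_ascFactorial_mul {p : ℂ[X]} (hp : ∀ a, p.IsRoot a → 0 < a) (m : ℕ) :
    ∃ q : ℂ[X], (∀ a, q.IsRoot a → 0 < a) ∧
      ∀ k, q.coeff k = ((k + 1).ascFactorial m : ℂ) * p.coeff k := by
  induction m with
  | zero => exact ⟨p, hp, by simp⟩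
  | succ m ih =>
    obtain ⟨q, hq, hqc⟩ := ih
    refine ⟨X * derivative q + C ((m + 1 : ℝ) : ℂ) * q,
      fun z hz => pos_of_isRoot_X_mul_derivative_add hq (by positivity) hz, fun k => ?_⟩
    have hX : (X * derivative q).coeff k = k * q.coeff k := by
      cases k with
      | zero => simp
      | succ k => rw [coeff_X_mul, coeff_derivative]; push_cast; ring
    rw [coeff_add, coeff_C_mul, hX, hqc, Nat.ascFactorial_succ]
    push_cast
    ring

end Polynomial

/-- all zeros of
`F_n(x) = ∑_{k=0}^n C(n,k) (n+κ)_k (−x)^k / (k! (ν₁+k)! ⋯ (ν_{r-1}+k)!)`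
are real and positive. -/
theorem zeros_real_positive (r : ℕ) (hr : 1 ≤ r) (ν : ℕ → ℕ) (κ : ℕ)
    (n : ℕ) (hn : 1 ≤ n) (z : ℂ)
    (hz : ∑ k ∈ Finset.range (n + 1),
        (n.choose k : ℂ) * (∏ j ∈ Finset.range k, ((n + κ + j : ℕ) : ℂ)) * (-z) ^ k /
          ((k.factorial : ℂ) * ∏ i ∈ Finset.range (r - 1), ((ν (i + 1) + k).factorial : ℂ)) = 0) :
    z.im = 0 ∧ 0 < z.re := by
  obtain ⟨m, hm⟩ : ∃ m, n + κ = m + 1 := ⟨n + κ - 1, by omega⟩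
  have hroots : ∀ a, ((X + C (-1) : ℂ[X]) ^ n).IsRoot a → 0 < a := by
    intro a ha
    rw [IsRoot.def, eval_pow, eval_add, eval_X, eval_C, ← sub_eq_add_neg] at ha
    rw [sub_eq_zero.mp (eq_zero_of_pow_eq_zero ha)]
    exact one_pos
  obtain ⟨p, hp, hpc⟩ := exists_coeff_eq_ascFactorial_mul hroots m
  obtain ⟨q, hq, hqc⟩ := exists_coeff_eq_div_prod_factorial hp (fun i => ν (i + 1)) (r - 1)
  have hdeg : q.natDegree < n + 1 := by
    rw [Nat.lt_succ_iff, natDegree_le_iff_coeff_eq_zero]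
    intro k hk
    rw [hqc, hpc, coeff_X_add_C_pow, Nat.choose_eq_zero_of_lt hk]
    simp
  suffices h : q.IsRoot z by
    obtain ⟨h1, h2⟩ := Complex.pos_iff.mp (hq z h)
    exact ⟨h2.symm, h1⟩
  rw [IsRoot.def, eval_eq_sum_range' hdeg,
    ← mul_zero ((-1 : ℂ) ^ n * (m.factorial : ℂ)), ← hz, mul_sum]
  refine sum_congr rfl fun k hk => ?_
  have hkn : k ≤ n := Nat.lt_succ_iff.mp (mem_range.mp hk)
  have hasc : (k.factorial : ℂ) * ((k + 1).ascFactorial m : ℂ) =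
      m.factorial * ((m + 1).ascFactorial k : ℂ) := by
    exact_mod_cast (Nat.factorial_mul_ascFactorial k m).trans
      ((congrArg Nat.factorial (add_comm k m)).trans (Nat.factorial_mul_ascFactorial m k).symm)
  have hprod : ∏ j ∈ range k, ((n + κ + j : ℕ) : ℂ) = ((m + 1).ascFactorial k : ℂ) := by
    rw [Nat.ascFactorial_eq_prod_range, Nat.cast_prod, hm]
  have hsign : (-1 : ℂ) ^ n * (-z) ^ k = (-1) ^ (n - k) * z ^ k := by
    obtain ⟨d, rfl⟩ := Nat.exists_eq_add_of_le hkn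
    rw [neg_pow z, Nat.add_sub_cancel_left, pow_add]
    have hsq : (-1 : ℂ) ^ k * (-1) ^ k = 1 := by rw [← mul_pow]; simp
    linear_combination ((-1 : ℂ) ^ d * z ^ k) * hsq
  have hk0 : (k.factorial : ℂ) ≠ 0 := Nat.cast_ne_zero.mpr (Nat.factorial_ne_zero _)
  have hP : ∏ i ∈ range (r - 1), ((ν (i + 1) + k).factorial : ℂ) ≠ 0 :=
    prod_ne_zero_iff.mpr fun i _ => Nat.cast_ne_zero.mpr (Nat.factorial_ne_zero _)
  rw [hqc, hpc, coeff_X_add_C_pow, hprod]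
  field_simp
  linear_combination ((-1 : ℂ) ^ (n - k) * n.choose k * z ^ k) * hasc -
    (m.factorial * n.choose k * (m + 1).ascFactorial k : ℂ) * hsign
end

section
/- Let r ≥ 2 be an integer, and define f : (0, π/(r+1)) → ℝ by f(φ) = π/2 − (r−1)·a(φ)·sin(φ) + arctan((1 − a(φ)²)/(2·a(φ)·sin(φ))), where a(φ) = (sin((r+1)φ)/sin((r−1)φ))^{1/2}. Then f is a strictly increasing bijection from (0, π/(r+1)) onto (0, π). -/
open Real Set

lemma mul_sin_lt_mul_sin {s t : ℝ} (hs : 0 < s) (hst : s < t) (ht : t ≤ π) :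
    s * sin t < t * sin s := by
  have ht0 : 0 < t := hs.trans hst
  have h := strictConcaveOn_sin_Icc.2 (left_mem_Icc.2 pi_pos.le) ⟨ht0.le, ht⟩ ht0.ne
    (sub_pos.2 ((div_lt_one ht0).2 hst)) (div_pos hs ht0) (by ring)
  simp only [smul_eq_mul, mul_zero, sin_zero, zero_add, div_mul_cancel₀ _ ht0.ne'] at h
  rwa [div_mul_eq_mul_div, div_lt_iff₀ ht0, mul_comm (sin s)] at h

lemma sin_sq_div_add_lt {A B : ℝ} (hA : 0 < A) (hB : 0 < B) (hAB : A + B < π) :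
    sin (A + B) ^ 2 / (A + B) < sin A ^ 2 / A + sin B ^ 2 / B := by
  have key : ∀ s t : ℝ, 0 < s → s < t → t < π → s * (sin t / t) ^ 2 < sin s ^ 2 / s := by
    intro s t hs hst ht
    have ht0 := hs.trans hst
    have hpos := sin_pos_of_pos_of_lt_pi ht0 ht
    have h : sin t / t < sin s / s := by
      rw [div_lt_div_iff₀ ht0 hs]
      linarith [mul_sin_lt_mul_sin hs hst ht.le]
    calc s * (sin t / t) ^ 2 < s * (sin s / s) ^ 2 := by gcongr
      _ = sin s ^ 2 / s := by field_simp
  have h1 := key A (A + B) hA (by linarith) hAB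
  have h2 := key B (A + B) hB (by linarith) hAB
  calc sin (A + B) ^ 2 / (A + B) = A * (sin (A + B) / (A + B)) ^ 2
        + B * (sin (A + B) / (A + B)) ^ 2 := by field_simp
    _ < _ := add_lt_add h1 h2

lemma arctan_div_sqrt_one_sub_sq {u : ℝ} (h1 : -1 < u) (h2 : u < 1) :
    arctan (u / √(1 - u ^ 2)) = π / 2 - arccos u := by
  rw [← arcsin_eq_arctan ⟨h1, h2⟩, arccos]
  ring

lemma sin_sub_one_mul_pos {r φ : ℝ} (hr : 2 ≤ r) (h0 : 0 < φ) (h1 : (r + 1) * φ ≤ π) :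
    0 < sin ((r - 1) * φ) :=
  sin_pos_of_pos_of_lt_pi (mul_pos (by linarith) h0) (by nlinarith)

lemma cos_pos_of_add_one_mul_le_pi {r φ : ℝ} (hr : 2 ≤ r) (h0 : 0 ≤ φ)
    (h1 : (r + 1) * φ ≤ π) : 0 < cos φ :=
  cos_pos_of_mem_Ioo ⟨by linarith [pi_pos], by nlinarith [pi_pos]⟩

lemma sqrt_one_sub_sq_cos_mul_div_cos {r φ : ℝ} (hr : 2 ≤ r) (h0 : 0 < φ)
    (h1 : (r + 1) * φ ≤ π) :
    √(1 - (cos (r * φ) / cos φ) ^ 2) =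
      √(sin ((r + 1) * φ) / sin ((r - 1) * φ)) * sin ((r - 1) * φ) / cos φ := by
  have hS := sin_sub_one_mul_pos hr h0 h1
  have hc := cos_pos_of_add_one_mul_le_pi hr h0.le h1
  have hP : 0 ≤ sin ((r + 1) * φ) := sin_nonneg_of_nonneg_of_le_pi (by nlinarith) h1
  rw [sqrt_eq_iff_eq_sq (sub_nonneg.2 ?_) (by positivity), div_pow, div_pow, mul_pow,
    sq_sqrt (by positivity)]
  all_goals
    have hid : sin ((r + 1) * φ) * sin ((r - 1) * φ) = cos φ ^ 2 - cos (r * φ) ^ 2 := by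
      rw [add_mul, sub_mul, one_mul, sin_add, sin_sub]
      linear_combination cos φ ^ 2 * sin_sq_add_cos_sq (r * φ)
        - cos (r * φ) ^ 2 * sin_sq_add_cos_sq φ
  · generalize sin ((r + 1) * φ) = P, sin ((r - 1) * φ) = S at *
    field_simp
    linarith
  · rw [div_pow, div_le_one (by positivity)]
    nlinarith

lemma cos_mul_div_cos_mem_Ioo {r φ : ℝ} (hr : 2 ≤ r) (h0 : 0 < φ) (h1 : (r + 1) * φ < π) :
    cos (r * φ) / cos φ ∈ Ioo (-1) 1 := by
  have hS := sin_sub_one_mul_pos hr h0 h1.le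
  have hc := cos_pos_of_add_one_mul_le_pi hr h0.le h1.le
  have hP : 0 < sin ((r + 1) * φ) := sin_pos_of_pos_of_lt_pi (by nlinarith) h1
  have h : 0 < √(1 - (cos (r * φ) / cos φ) ^ 2) := by
    rw [sqrt_one_sub_sq_cos_mul_div_cos hr h0 h1.le]
    positivity
  exact abs_lt.1 ((sq_lt_one_iff_abs_lt_one _).1 (by linarith [sqrt_pos.1 h]))

lemma arctan_eq_pi_div_two_sub_arccos {r φ : ℝ} (hr : 2 ≤ r) (h0 : 0 < φ)
    (h1 : (r + 1) * φ < π) :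
    arctan ((1 - √(sin ((r + 1) * φ) / sin ((r - 1) * φ)) ^ 2) /
        (2 * √(sin ((r + 1) * φ) / sin ((r - 1) * φ)) * sin φ)) =
      arccos (cos (r * φ) / cos φ) - π / 2 := by
  have hS := sin_sub_one_mul_pos hr h0 h1.le
  have hc := cos_pos_of_add_one_mul_le_pi hr h0.le h1.le
  have hP : 0 < sin ((r + 1) * φ) := sin_pos_of_pos_of_lt_pi (by nlinarith) h1
  have hs : 0 < sin φ := sin_pos_of_pos_of_lt_pi h0 (by nlinarith)
  obtain ⟨hu1, hu2⟩ := cos_mul_div_cos_mem_Ioo hr h0 h1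
  rw [← neg_sub (π / 2), ← arctan_div_sqrt_one_sub_sq hu1 hu2, ← arctan_neg,
    sqrt_one_sub_sq_cos_mul_div_cos hr h0 h1.le, sq_sqrt (by positivity)]
  have ha : 0 < √(sin ((r + 1) * φ) / sin ((r - 1) * φ)) := by positivity
  set a := √(sin ((r + 1) * φ) / sin ((r - 1) * φ))
  have hid : sin ((r - 1) * φ) - sin ((r + 1) * φ) = -(2 * cos (r * φ) * sin φ) := by
    rw [add_mul, sub_mul, one_mul, sin_add, sin_sub]
    ring
  congr 1
  clear_value a
  generalize sin ((r + 1) * φ) = P, sin ((r - 1) * φ) = S at *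
  field_simp
  linear_combination hid

lemma hasDerivAt_arccos_sub_sqrt_mul_sin {r φ : ℝ} (hr : 2 ≤ r) (h0 : 0 < φ)
    (h1 : (r + 1) * φ < π) :
    HasDerivAt (fun φ => arccos (cos (r * φ) / cos φ)
        - (r - 1) * √(sin ((r + 1) * φ) / sin ((r - 1) * φ)) * sin φ)
      (((r + 1) * sin ((r - 1) * φ) ^ 2 - (r - 1) * sin ((r + 1) * φ) ^ 2
          + (r ^ 2 - 1) / 2 * sin (2 * φ) ^ 2) /
        (2 * cos φ * √(sin ((r + 1) * φ) / sin ((r - 1) * φ)) * sin ((r - 1) * φ) ^ 2)) φ := by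
  have hS := sin_sub_one_mul_pos hr h0 h1.le
  have hc := cos_pos_of_add_one_mul_le_pi hr h0.le h1.le
  have hP : 0 < sin ((r + 1) * φ) := sin_pos_of_pos_of_lt_pi (by nlinarith) h1
  obtain ⟨hu1, hu2⟩ := cos_mul_div_cos_mem_Ioo hr h0 h1
  have hlin (k : ℝ) : HasDerivAt (fun x : ℝ => k * x) k φ := by
    simpa using (hasDerivAt_id φ).const_mul k
  have hu := ((hlin r).cos.div (hasDerivAt_cos φ) hc.ne')
  have harc := (hasDerivAt_arccos hu1.ne' hu2.ne).comp φ hu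
  have hR := ((hlin (r + 1)).sin.div (hlin (r - 1)).sin hS.ne').sqrt (div_pos hP hS).ne'
  have hb := (hR.const_mul (r - 1)).mul (hasDerivAt_sin φ)
  refine (harc.sub hb).congr_deriv ?_
  simp only [Pi.div_apply]
  rw [sqrt_one_sub_sq_cos_mul_div_cos hr h0 h1.le]
  have ha : 0 < √(sin ((r + 1) * φ) / sin ((r - 1) * φ)) := by positivity
  have haa : √(sin ((r + 1) * φ) / sin ((r - 1) * φ)) ^ 2 * sin ((r - 1) * φ)
      = sin ((r + 1) * φ) := by
    rw [sq_sqrt (by positivity), div_mul_cancel₀ _ hS.ne']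
  set a := √(sin ((r + 1) * φ) / sin ((r - 1) * φ))
  have hpoly : 2 * (r * sin (r * φ) * cos φ - cos (r * φ) * sin φ) * sin ((r - 1) * φ)
      - (r - 1) * (((r + 1) * cos ((r + 1) * φ) * sin ((r - 1) * φ)
          - (r - 1) * cos ((r - 1) * φ) * sin ((r + 1) * φ)) * sin φ * cos φ
        + 2 * sin ((r + 1) * φ) * sin ((r - 1) * φ) * cos φ ^ 2)
      = (r + 1) * sin ((r - 1) * φ) ^ 2 - (r - 1) * sin ((r + 1) * φ) ^ 2
          + (r ^ 2 - 1) / 2 * sin (2 * φ) ^ 2 := by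
    have e1 : sin ((r + 1) * φ) = sin (r * φ) * cos φ + cos (r * φ) * sin φ := by
      rw [add_mul, one_mul, sin_add]
    have e2 : sin ((r - 1) * φ) = sin (r * φ) * cos φ - cos (r * φ) * sin φ := by
      rw [sub_mul, one_mul, sin_sub]
    have e3 : cos ((r + 1) * φ) = cos (r * φ) * cos φ - sin (r * φ) * sin φ := by
      rw [add_mul, one_mul, cos_add]
    have e4 : cos ((r - 1) * φ) = cos (r * φ) * cos φ + sin (r * φ) * sin φ := by
      rw [sub_mul, one_mul, cos_sub]
    rw [sin_two_mul, e1, e2, e3, e4]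
    have hs2 : sin φ ^ 2 = 1 - cos φ ^ 2 := sin_sq φ
    have hx2 := sin_sq_add_cos_sq (r * φ)
    have hy2 := sin_sq_add_cos_sq φ
    generalize sin (r * φ) = x, cos (r * φ) = y, sin φ = s, cos φ = c at *
    linear_combination 2 * (r ^ 2 - 1) * s ^ 2 * c ^ 2 * hx2
      - (2 * (r * x * c - y * s) * (x * c - y * s) - (r + 1) * (x * c - y * s) ^ 2
        + (r - 1) * (x * c + y * s) ^ 2) * hy2
  rw [← hpoly, ← haa]
  field_simp
  ring

lemma continuousOn_arccos_sub_sqrt_mul_sin {r : ℝ} (hr : 2 ≤ r) :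
    ContinuousOn (fun φ => arccos (cos (r * φ) / cos φ)
        - (r - 1) * √(sin ((r + 1) * φ) / sin ((r - 1) * φ)) * sin φ)
      (Icc 0 (π / (r + 1))) := by
  have hr1 : 0 < r + 1 := by linarith
  intro φ hφ
  have hmem : ∀ ψ ∈ Icc 0 (π / (r + 1)), (r + 1) * ψ ≤ π := fun ψ hψ => by
    have := (le_div_iff₀ hr1).1 hψ.2
    linarith
  have h1 := hmem φ hφ
  have hc := cos_pos_of_add_one_mul_le_pi hr hφ.1 h1
  apply ContinuousWithinAt.sub
  · apply ContinuousAt.continuousWithinAt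
    have : ContinuousAt (fun φ => cos (r * φ) / cos φ) φ :=
      ContinuousAt.div (by fun_prop) (by fun_prop) hc.ne'
    exact continuous_arccos.continuousAt.comp this
  rcases hφ.1.eq_or_lt with rfl | h0
  · have hlim : Filter.Tendsto (fun ψ : ℝ => (r - 1) * 2 * sin ψ)
        (nhdsWithin 0 (Icc 0 (π / (r + 1)))) (nhds 0) := by
      have : Continuous (fun ψ : ℝ => (r - 1) * 2 * sin ψ) := by fun_prop
      simpa using this.continuousWithinAt.tendsto (x := 0) (s := Icc 0 (π / (r + 1)))
    rw [ContinuousWithinAt, sin_zero, mul_zero]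
    refine squeeze_zero' ?_ ?_ hlim
    all_goals
      filter_upwards [self_mem_nhdsWithin] with ψ hψ
      have h1 := hmem ψ hψ
      have hs : 0 ≤ sin ψ := sin_nonneg_of_nonneg_of_le_pi hψ.1 (by nlinarith [hψ.1])
      have hr2 : 0 ≤ r - 1 := by linarith
    · positivity
    · gcongr
      rw [sqrt_le_left (by norm_num)]
      rcases hψ.1.eq_or_lt with rfl | h0
      · norm_num
      · have hS := sin_sub_one_mul_pos hr h0 h1
        rw [div_le_iff₀ hS]
        have := mul_sin_lt_mul_sin (mul_pos (by linarith : 0 < r - 1) h0)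
          (by nlinarith : (r - 1) * ψ < (r + 1) * ψ) h1
        have h2 : (r - 1) * sin ((r + 1) * ψ) < (r + 1) * sin ((r - 1) * ψ) := by
          nlinarith
        nlinarith
  · have hS := sin_sub_one_mul_pos hr h0 h1
    apply ContinuousAt.continuousWithinAt
    have : ContinuousAt (fun φ => sin ((r + 1) * φ) / sin ((r - 1) * φ)) φ :=
      ContinuousAt.div (by fun_prop) (by fun_prop) hS.ne'
    exact (continuousAt_const.mul this.sqrt).mul continuous_sin.continuousAt

lemma strictMonoOn_arccos_sub_sqrt_mul_sin {r : ℝ} (hr : 2 ≤ r) :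
    StrictMonoOn (fun φ => arccos (cos (r * φ) / cos φ)
        - (r - 1) * √(sin ((r + 1) * φ) / sin ((r - 1) * φ)) * sin φ)
      (Icc 0 (π / (r + 1))) := by
  have hr1 : 0 < r + 1 := by linarith
  have hr2 : 0 < r - 1 := by linarith
  refine strictMonoOn_of_deriv_pos (convex_Icc _ _) (continuousOn_arccos_sub_sqrt_mul_sin hr) ?_
  intro φ hφ
  rw [interior_Icc] at hφ
  have h0 := hφ.1
  have h1 : (r + 1) * φ < π := by
    have := (lt_div_iff₀ hr1).1 hφ.2
    linarith
  have hS := sin_sub_one_mul_pos hr h0 h1.le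
  have hc := cos_pos_of_add_one_mul_le_pi hr h0.le h1.le
  have hP : 0 < sin ((r + 1) * φ) := sin_pos_of_pos_of_lt_pi (by nlinarith) h1
  rw [(hasDerivAt_arccos_sub_sqrt_mul_sin hr h0 h1).deriv]
  apply div_pos _ (by positivity)
  have h := sin_sq_div_add_lt (mul_pos hr2 h0) (mul_pos two_pos h0) (by linarith)
  rw [show (r - 1) * φ + 2 * φ = (r + 1) * φ by ring, ← sub_pos] at h
  have h' := mul_pos (mul_pos (mul_pos hr1 hr2) h0) h
  convert h' using 1
  field_simp
  ring

/-- `f(φ) = π/2 − (r−1)a(φ)sin(φ) + arctan((1−a(φ)²)/(2a(φ)sin(φ)))`,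
with `a(φ) = (sin((r+1)φ)/sin((r−1)φ))^{1/2}`, is a strictly increasing bijection from
`(0, π/(r+1))` onto `(0, π)`. -/
theorem f_strictMono_bijOn (r : ℕ) (hr : 2 ≤ r) :
    let a : ℝ → ℝ := fun φ =>
      Real.sqrt (Real.sin (((r : ℝ) + 1) * φ) / Real.sin (((r : ℝ) - 1) * φ))
    let f : ℝ → ℝ := fun φ =>
      π / 2 - ((r : ℝ) - 1) * a φ * Real.sin φ +
        Real.arctan ((1 - a φ ^ 2) / (2 * a φ * Real.sin φ))
    StrictMonoOn f (Set.Ioo 0 (π / (r + 1))) ∧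
      Set.BijOn f (Set.Ioo 0 (π / (r + 1))) (Set.Ioo 0 π) := by
  intro a f
  have hr' : (2 : ℝ) ≤ r := by exact_mod_cast hr
  have hr1 : (0 : ℝ) < r + 1 := by linarith
  have hb : 0 < π / ((r : ℝ) + 1) := div_pos pi_pos hr1
  set F : ℝ → ℝ := fun φ => arccos (cos (r * φ) / cos φ)
        - (r - 1) * √(sin ((r + 1) * φ) / sin ((r - 1) * φ)) * sin φ with hF
  have hEq : EqOn F f (Ioo 0 (π / (r + 1))) := by
    intro φ hφ
    have h1 : (r + 1) * φ < π := by
      have := (lt_div_iff₀ hr1).1 hφ.2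
      linarith
    simp only [hF, f, a, arctan_eq_pi_div_two_sub_arccos hr' hφ.1 h1]
    ring
  have hmono : StrictMonoOn F (Icc 0 (π / (r + 1))) := strictMonoOn_arccos_sub_sqrt_mul_sin hr'
  have hF0 : F 0 = 0 := by simp [hF]
  have hF1 : F (π / (r + 1)) = π := by
    have e : (r : ℝ) * (π / (r + 1)) = π - π / (r + 1) := by field_simp; ring
    have hc : 0 < cos (π / ((r : ℝ) + 1)) :=
      cos_pos_of_add_one_mul_le_pi hr' hb.le (by rw [mul_div_cancel₀ _ hr1.ne'])
    simp only [hF]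
    rw [e, cos_pi_sub, neg_div, div_self hc.ne', mul_div_cancel₀ _ hr1.ne']
    simp
  have hmono' := hmono.mono Ioo_subset_Icc_self
  refine ⟨hmono'.congr hEq, BijOn.congr ⟨?_, hmono'.injOn, ?_⟩ hEq⟩
  · intro φ hφ
    have h0 := hmono (left_mem_Icc.2 hb.le) (Ioo_subset_Icc_self hφ) hφ.1
    have h1 := hmono (Ioo_subset_Icc_self hφ) (right_mem_Icc.2 hb.le) hφ.2
    rw [hF0] at h0
    rw [hF1] at h1
    exact ⟨h0, h1⟩
  · have := intermediate_value_Ioo hb.le (continuousOn_arccos_sub_sqrt_mul_sin hr')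
    change Ioo (F 0) (F (π / (r + 1))) ⊆ F '' _ at this
    rwa [hF0, hF1] at this
end
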